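/- Let A be a nonzero homogeneous polynomial of degree m ≥ 1 in d variables with complex coefficients that is hyperbolic in direction u ∈ ℝ^d. Fix x ∈ ℝ^d with A(x) = 0, and let a := hom(A, x) be the sum of the monomials of minimal total degree in the polynomial w ↦ A(x + w). Then a is hyperbolic in direction u. Consequently, if B is any connected subset of the set of directions of hyperbolicity of A, then B is contained in a single connected component of the set of directions of hyperbolicity of a. -/

import Mathlib

open MvPolynomial

/-- Hyperbolicity of a complex polynomial in a real direction. -/
def IsHyperbolicDir {d : ℕ} (A : MvPolynomial (Fin d) ℂ) (v : Fin d → ℝ) : Prop :=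
  eval (fun j => (v j : ℂ)) A ≠ 0 ∧
    ∀ x : Fin d → ℝ, ∀ t : ℂ,
      eval (fun j => (x j : ℂ) + t * (v j : ℂ)) A = 0 → t.im = 0

/-- The polynomial `w ↦ A(x + w)`, obtained by substituting `X j ↦ x j + X j`. -/
noncomputable def translateC {d : ℕ} (A : MvPolynomial (Fin d) ℂ) (x : Fin d → ℝ) :
    MvPolynomial (Fin d) ℂ :=
  bind₁ (fun j => C ((x j : ℂ)) + X j) A

open Filter Topology

/-- The inclusion of real vectors into complex vectors. -/
def complexVec {d : ℕ} (v : Fin d → ℝ) : Fin d → ℂ := fun j => (v j : ℂ)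

lemma complexVec_add {d : ℕ} (v w : Fin d → ℝ) :
    complexVec (v + w) = complexVec v + complexVec w := by
  ext j; simp [complexVec]

lemma complexVec_smul {d : ℕ} (r : ℝ) (v : Fin d → ℝ) :
    complexVec (r • v) = (r : ℂ) • complexVec v := by
  ext j; simp [complexVec]

lemma MvPolynomial.IsHomogeneous.eval_const_smul {d m : ℕ} {A : MvPolynomial (Fin d) ℂ}
    (hA : A.IsHomogeneous m) (c : ℂ) (z : Fin d → ℂ) :
    eval (c • z) A = c ^ m * eval z A := by
  rw [eval_eq, eval_eq, Finset.mul_sum]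
  refine Finset.sum_congr rfl fun e he => ?_
  have h := hA (mem_support_iff.mp he)
  rw [Finsupp.weight_apply, Finsupp.sum] at h
  simp only [Pi.one_apply, smul_eq_mul, mul_one] at h
  simp only [Pi.smul_apply, smul_eq_mul, mul_pow, Finset.prod_mul_distrib,
    Finset.prod_pow_eq_pow_sum, h]
  ring

/-- The restriction of a polynomial to a complex line. -/
noncomputable def restrictLine {d : ℕ} (A : MvPolynomial (Fin d) ℂ) (z v : Fin d → ℂ) :
    Polynomial ℂ :=
  aeval (fun j => Polynomial.C (v j) * Polynomial.X + Polynomial.C (z j)) A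

lemma eval_restrictLine {d : ℕ} (A : MvPolynomial (Fin d) ℂ) (z v : Fin d → ℂ) (t : ℂ) :
    (restrictLine A z v).eval t = eval (z + t • v) A := by
  unfold restrictLine
  rw [← Polynomial.coe_evalRingHom, ← RingHom.coe_coe (aeval _), ← RingHom.comp_apply]
  congr 1
  refine MvPolynomial.ringHom_ext (fun r => by simp [Polynomial.algebraMap_eq]) fun j => ?_
  simp
  ring

lemma natDegree_restrictLine_le {d : ℕ} (A : MvPolynomial (Fin d) ℂ) (z v : Fin d → ℂ) :
    (restrictLine A z v).natDegree ≤ A.totalDegree := by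
  simpa [restrictLine] using aeval_natDegree_le A le_rfl _ fun j => Polynomial.natDegree_linear_le (a := v j)
    (b := z j)

lemma Polynomial.norm_eval_le_of_roots {P : Polynomial ℂ} {N : ℕ} (hN : P.natDegree ≤ N)
    {ρ : ℝ} (hρ : 0 < ρ) (hr : ∀ r, P.eval r = 0 → ρ ≤ ‖r‖) (s : ℂ) :
    ‖P.eval s‖ ≤ (1 + ‖s‖ / ρ) ^ N * ‖P.eval 0‖ := by
  by_cases hP : P = 0
  · simp [hP]
  have hsp := IsAlgClosed.splits P
  have key : ∀ R : Multiset ℂ, (∀ r ∈ R, ρ ≤ ‖r‖) →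
      ‖(R.map (s - ·)).prod‖ ≤ (1 + ‖s‖ / ρ) ^ R.card * ‖(R.map (0 - ·)).prod‖ := by
    intro R
    induction R using Multiset.induction with
    | empty => simp
    | cons r R ih =>
      intro h
      have h1 := ih fun q hq => h q (Multiset.mem_cons_of_mem hq)
      have h2 : ‖s - r‖ ≤ (1 + ‖s‖ / ρ) * ‖r‖ := by
        have h3 : ρ ≤ ‖r‖ := h r (Multiset.mem_cons_self _ _)
        have h4 : ‖s‖ ≤ ‖s‖ / ρ * ‖r‖ := by
          rw [div_mul_eq_mul_div, le_div_iff₀ hρ]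
          gcongr
        linarith [norm_sub_le s r]
      simp only [Multiset.map_cons, Multiset.prod_cons, Multiset.card_cons, norm_mul, zero_sub,
        norm_neg] at h1 ⊢
      calc _ ≤ _ := mul_le_mul h2 h1 (norm_nonneg _) (by positivity)
        _ = _ := by ring
  have hroots := key P.roots fun r h => hr r (Polynomial.isRoot_of_mem_roots h)
  rw [hsp.eval_eq_prod_roots, hsp.eval_eq_prod_roots, norm_mul, norm_mul]
  have hcard : P.roots.card ≤ N := (Polynomial.card_roots' P).trans hN
  have h1 : (1 + ‖s‖ / ρ) ^ P.roots.card ≤ (1 + ‖s‖ / ρ) ^ N :=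
    pow_le_pow_right₀ (le_add_of_nonneg_right (by positivity)) hcard
  calc _ ≤ ‖P.leadingCoeff‖ * ((1 + ‖s‖ / ρ) ^ N * ‖(P.roots.map (0 - ·)).prod‖) := by
        gcongr
        exact hroots.trans (by gcongr)
    _ = _ := by ring

lemma norm_eval_add_smul_le {d : ℕ} (A : MvPolynomial (Fin d) ℂ) (z v : Fin d → ℂ)
    {ρ : ℝ} (hρ : 0 < ρ) (hr : ∀ r : ℂ, eval (z + r • v) A = 0 → ρ ≤ ‖r‖) (s : ℂ) :
    ‖eval (z + s • v) A‖ ≤ (1 + ‖s‖ / ρ) ^ A.totalDegree * ‖eval z A‖ := by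
  have := Polynomial.norm_eval_le_of_roots (natDegree_restrictLine_le A z v) hρ
    (fun r h => hr r (by rwa [eval_restrictLine] at h)) s
  simpa [eval_restrictLine] using this

lemma IsHyperbolicDir.im_eq_zero {d : ℕ} {A : MvPolynomial (Fin d) ℂ} {u : Fin d → ℝ}
    (hu : IsHyperbolicDir A u) (y : Fin d → ℝ) {t : ℂ}
    (h : eval (complexVec y + t • complexVec u) A = 0) : t.im = 0 := hu.2 y t h

/-- Directions that are joined to `u` by a ray in direction `u` avoiding the zero set of `A`
can be added to `u` in the tube domain. -/
lemma IsHyperbolicDir.eval_add_smul_add_I_smul_ne_zero {d m : ℕ} {A : MvPolynomial (Fin d) ℂ}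
    (hA : A.IsHomogeneous m) {u v : Fin d → ℝ} (hu : IsHyperbolicDir A u)
    (hv : ∀ t : ℝ, 0 ≤ t → eval (complexVec v + (t : ℂ) • complexVec u) A ≠ 0)
    (z : Fin d → ℝ) (s : ℂ) (hs : 0 ≤ s.im) :
    eval (complexVec z + s • complexVec v + Complex.I • complexVec u) A ≠ 0 := by
  intro hzero
  let f : ℝ → ℂ → Fin d → ℂ := fun β s =>
    (β : ℂ) • complexVec z + s • complexVec v + Complex.I • complexVec u
  have hf : Continuous fun p : ℝ × ℂ => eval (f p.1 p.2) A :=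
    (continuous_eval A).comp (by fun_prop)
  have hv0 : eval (complexVec v) A ≠ 0 := by simpa using hv 0 le_rfl
  have hreal : ∀ (β : ℝ) (s : ℂ), s.im = 0 → eval (f β s) A ≠ 0 := by
    intro β s hs h
    have := hu.im_eq_zero (β • z + s.re • v) (t := Complex.I) (by
      rw [complexVec_add, complexVec_smul, complexVec_smul,
        show ((s.re : ℝ) : ℂ) = s from Complex.ext rfl (by simp [hs])]
      exact h)
    simp at this
  obtain ⟨ε, hε, hball⟩ : ∃ ε > 0, ∀ q : Fin d → ℂ, ‖q‖ < ε → eval (complexVec v + q) A ≠ 0 := by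
    have hc : Continuous fun q : Fin d → ℂ => eval (complexVec v + q) A :=
      (continuous_eval A).comp (by fun_prop)
    have h := hc.continuousAt.eventually_ne (x := 0) (y := 0) (by simpa using hv0)
    obtain ⟨ε, hε, h⟩ := Metric.eventually_nhds_iff.mp h
    exact ⟨ε, hε, fun q hq => h (by simpa using hq)⟩
  have hbound : ∀ β : ℝ, β ∈ Set.Icc (0 : ℝ) 1 → ∀ s : ℂ, eval (f β s) A = 0 →
      ‖s‖ ≤ (‖complexVec z‖ + ‖complexVec u‖) / ε := by
    intro β hβ s h
    by_cases hs0 : s = 0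
    · rw [hs0, norm_zero]; positivity
    by_contra! hlt
    set q : Fin d → ℂ := s⁻¹ • ((β : ℂ) • complexVec z + Complex.I • complexVec u) with hq
    have hfs : f β s = s • (complexVec v + q) := by
      simp only [f, hq]
      rw [smul_add s, smul_inv_smul₀ hs0]
      abel
    rw [hfs, hA.eval_const_smul] at h
    refine hball q ?_ ((mul_eq_zero.mp h).resolve_left (pow_ne_zero _ hs0))
    have h1 : ‖(β : ℂ) • complexVec z + Complex.I • complexVec u‖
        ≤ ‖complexVec z‖ + ‖complexVec u‖ := by
      refine (norm_add_le _ _).trans ?_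
      rw [norm_smul, norm_smul, Complex.norm_I, one_mul, Complex.norm_real,
        Real.norm_of_nonneg hβ.1]
      gcongr
      exact mul_le_of_le_one_left (norm_nonneg _) hβ.2
    rw [hq, norm_smul, norm_inv, inv_mul_lt_iff₀ (norm_pos_iff.mpr hs0)]
    rw [div_lt_iff₀ hε] at hlt
    exact h1.trans_lt hlt
  let K : Set (ℝ × ℂ) := {p | p.1 ∈ Set.Icc (0 : ℝ) 1 ∧ 0 ≤ p.2.im ∧ eval (f p.1 p.2) A = 0}
  have hKclosed : IsClosed K :=
    (isClosed_Icc.preimage continuous_fst).inter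
      ((isClosed_le continuous_const (Complex.continuous_im.comp continuous_snd)).inter
        (isClosed_eq hf continuous_const))
  have hK : IsCompact K := by
    refine ((isCompact_Icc (a := (0 : ℝ)) (b := 1)).prod (isCompact_closedBall (0 : ℂ)
      ((‖complexVec z‖ + ‖complexVec u‖) / ε))).of_isClosed_subset hKclosed ?_
    rintro ⟨β, s⟩ ⟨h1, -, h3⟩
    exact ⟨h1, by simpa using hbound β h1 s h3⟩
  have hKne : K.Nonempty := ⟨(1, s), by simp, hs, by simpa [f] using hzero⟩
  obtain ⟨⟨β₀, s₀⟩, ⟨hβ₀, hs₀, h₀⟩, hmin⟩ := hK.exists_isMinOn hKne continuous_fst.continuousOn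
  dsimp only at hβ₀ hs₀ h₀
  have hs₀pos : 0 < s₀.im := lt_of_le_of_ne hs₀ fun h => hreal β₀ s₀ h.symm h₀
  have hs₀ne : s₀ ≠ 0 := fun h => by simp [h] at hs₀pos
  have hβ₀pos : 0 < β₀ := by
    refine lt_of_le_of_ne hβ₀.1 fun h => ?_
    have hfs : f β₀ s₀ = s₀ • (complexVec v + (Complex.I / s₀) • complexVec u) := by
      simp only [f, ← h]
      rw [smul_add s₀, smul_smul, mul_div_cancel₀ _ hs₀ne]
      simp
    rw [hfs, hA.eval_const_smul] at h₀
    have h1 := (mul_eq_zero.mp h₀).resolve_left (pow_ne_zero _ hs₀ne)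
    have him := hu.im_eq_zero v h1
    have hre : Complex.I / s₀ = ((Complex.I / s₀).re : ℂ) := Complex.ext rfl (by simp [him])
    rw [hre] at h1
    refine hv _ ?_ h1
    rw [Complex.div_re]
    simp only [Complex.I_re, Complex.I_im, zero_mul, zero_div, one_mul, zero_add]
    exact div_nonneg hs₀ (Complex.normSq_nonneg s₀)
  have hle : ∀ᶠ β in 𝓝[<] β₀, ‖eval (f β 0) A‖ ≤
      (1 + ‖-s₀‖ / s₀.im) ^ A.totalDegree * ‖eval (f β s₀) A‖ := by
    filter_upwards [Ioo_mem_nhdsLT hβ₀pos] with β hβ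
    have hadd : ∀ r : ℂ, f β s₀ + r • complexVec v = f β (s₀ + r) := by
      intro r; simp only [f, add_smul]; abel
    have := norm_eval_add_smul_le A (f β s₀) (complexVec v) hs₀pos (fun r hr => ?_) (-s₀)
    · rwa [hadd, add_neg_cancel] at this
    rw [hadd] at hr
    by_contra! hlt
    have h1 : 0 ≤ (s₀ + r).im := by
      have := (abs_le.mp (Complex.abs_im_le_norm r)).1
      rw [Complex.add_im]; linarith
    have : β₀ ≤ β := hmin (a := (β, s₀ + r)) ⟨⟨hβ.1.le, hβ.2.le.trans hβ₀.2⟩, h1, hr⟩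
    linarith [hβ.2]
  have hc : ∀ s : ℂ, Tendsto (fun β : ℝ => ‖eval (f β s) A‖) (𝓝[<] β₀)
      (𝓝 ‖eval (f β₀ s) A‖) := by
    intro s
    have h : Continuous fun β : ℝ => ‖eval (f β s) A‖ :=
      (hf.comp (by fun_prop : Continuous fun β : ℝ => (β, s))).norm
    exact (h.tendsto β₀).mono_left nhdsWithin_le_nhds
  have hlim := le_of_tendsto_of_tendsto (hc 0) ((hc s₀).const_mul _) hle
  rw [h₀, norm_zero, mul_zero] at hlim
  exact hreal β₀ 0 (by simp) (norm_le_zero_iff.mp hlim)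

/-- A quantitative form of the openness of the cone of hyperbolicity. -/
lemma IsHyperbolicDir.exists_ball_eval_ne_zero {d m : ℕ} {A : MvPolynomial (Fin d) ℂ}
    (hA : A.IsHomogeneous m) {u : Fin d → ℝ} (hu : IsHyperbolicDir A u) (y : Fin d → ℝ) :
    ∃ c > 0, ∀ (z : Fin d → ℝ) (σ : ℂ), |σ.im| < c →
      eval (complexVec z + Complex.I • complexVec u + σ • complexVec y) A ≠ 0 := by
  obtain ⟨ε, hε, hne⟩ : ∃ ε > 0, ∀ r : ℝ, |r| < ε →
      eval (complexVec u + (r : ℂ) • complexVec y) A ≠ 0 := by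
    have hc : Continuous fun r : ℝ => eval (complexVec u + (r : ℂ) • complexVec y) A :=
      (continuous_eval A).comp (by fun_prop)
    have h := hc.continuousAt.eventually_ne (x := 0) (y := 0) (by simpa using! hu.1)
    obtain ⟨ε, hε, h⟩ := Metric.eventually_nhds_iff.mp h
    exact ⟨ε, hε, fun r hr => h (by simpa using hr)⟩
  refine ⟨ε / 2, by positivity, fun z σ hσ => ?_⟩
  have hv : ∀ t : ℝ, 0 ≤ t →
      eval (complexVec (u + (2 * σ.im) • y) + (t : ℂ) • complexVec u) A ≠ 0 := by
    intro t ht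
    have h1t : (1 + t : ℝ) ≠ 0 := by positivity
    have h1 : complexVec (u + (2 * σ.im) • y) + (t : ℂ) • complexVec u =
        ((1 + t : ℝ) : ℂ) • (complexVec u + ((2 * σ.im / (1 + t) : ℝ) : ℂ) • complexVec y) := by
      rw [smul_add, smul_smul, ← Complex.ofReal_mul, mul_div_cancel₀ _ h1t, complexVec_add,
        complexVec_smul]
      push_cast
      rw [add_smul, one_smul]
      abel
    rw [h1, hA.eval_const_smul]
    refine mul_ne_zero (pow_ne_zero _ (by exact_mod_cast h1t)) (hne _ ?_)
    rw [abs_div, abs_of_nonneg (by positivity : 0 ≤ 1 + t), div_lt_iff₀ (by positivity), abs_mul,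
      abs_of_pos (by norm_num : (0 : ℝ) < 2)]
    nlinarith
  have h := hu.eval_add_smul_add_I_smul_ne_zero hA hv ((2 : ℝ) • (z + σ.re • y)) Complex.I
    (by simp)
  have h2 : complexVec ((2 : ℝ) • (z + σ.re • y)) +
      Complex.I • complexVec (u + (2 * σ.im) • y) + Complex.I • complexVec u =
      (2 : ℂ) • (complexVec z + Complex.I • complexVec u + σ • complexVec y) := by
    conv_rhs => rw [← Complex.re_add_im σ]
    ext j
    simp only [complexVec, Pi.add_apply, Pi.smul_apply, smul_eq_mul]
    push_cast
    ring
  rw [h2, hA.eval_const_smul] at h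
  exact right_ne_zero_of_mul h

lemma eval_translateC {d : ℕ} (A : MvPolynomial (Fin d) ℂ) (x : Fin d → ℝ) (w : Fin d → ℂ) :
    eval w (translateC A x) = eval (complexVec x + w) A := by
  unfold translateC
  rw [← RingHom.coe_coe (bind₁ _), ← RingHom.comp_apply]
  congr 1
  exact MvPolynomial.ringHom_ext (fun r => by simp) fun j => by simp [complexVec]

/-- The lowest homogeneous component of `T` is the limit of the rescaled values of `T`. -/
lemma tendsto_eval_smul_div_pow {d k : ℕ} (T : MvPolynomial (Fin d) ℂ)
    (hk : ∀ j < k, homogeneousComponent j T = 0) (w : Fin d → ℂ) :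
    Tendsto (fun s : ℝ => eval ((s : ℂ) • w) T / (s : ℂ) ^ k) (𝓝[>] 0)
      (𝓝 (eval w (homogeneousComponent k T))) := by
  have hT : ∀ s : ℂ, eval (s • w) T = s ^ k * ∑ j ∈ Finset.range (T.totalDegree + 1),
      s ^ (j - k) * eval w (homogeneousComponent j T) := by
    intro s
    conv_lhs => rw [← sum_homogeneousComponent T]
    rw [map_sum, Finset.mul_sum]
    refine Finset.sum_congr rfl fun j _ => ?_
    by_cases hj : j < k
    · simp [hk j hj]
    · rw [(homogeneousComponent_isHomogeneous j T).eval_const_smul, ← mul_assoc, ← pow_add,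
        Nat.add_sub_cancel' (not_lt.mp hj)]
  have hc : Continuous fun s : ℝ => ∑ j ∈ Finset.range (T.totalDegree + 1),
      (s : ℂ) ^ (j - k) * eval w (homogeneousComponent j T) := by fun_prop
  have h0 : ∑ j ∈ Finset.range (T.totalDegree + 1),
      ((0 : ℝ) : ℂ) ^ (j - k) * eval w (homogeneousComponent j T) =
      eval w (homogeneousComponent k T) := by
    rw [Finset.sum_eq_single k]
    · simp
    · intro j _ hj
      rcases lt_or_gt_of_ne hj with h | h
      · simp [hk j h]
      · simp [Nat.sub_ne_zero_of_lt h]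
    · intro h
      rw [homogeneousComponent_eq_zero _ _ (by simpa using h)]
      simp
  have := (hc.tendsto 0).mono_left (nhdsWithin_le_nhds (s := Set.Ioi 0))
  rw [h0] at this
  refine this.congr' ?_
  filter_upwards [self_mem_nhdsWithin] with s hs
  have hs' : (s : ℂ) ≠ 0 := by exact_mod_cast (ne_of_gt hs)
  rw [hT, mul_div_cancel_left₀ _ (pow_ne_zero _ hs')]

lemma norm_eval_homogeneousComponent_translateC_le {d k : ℕ} {A : MvPolynomial (Fin d) ℂ}
    {x : Fin d → ℝ} (hk : ∀ j < k, homogeneousComponent j (translateC A x) = 0)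
    {w₁ w₀ : Fin d → ℂ} {M : ℝ}
    (h : ∀ s : ℝ, 0 < s → ‖eval (complexVec x + (s : ℂ) • w₁) A‖ ≤
      M * ‖eval (complexVec x + (s : ℂ) • w₀) A‖) :
    ‖eval w₁ (homogeneousComponent k (translateC A x))‖ ≤
      M * ‖eval w₀ (homogeneousComponent k (translateC A x))‖ := by
  refine le_of_tendsto_of_tendsto (tendsto_eval_smul_div_pow _ hk w₁).norm
    ((tendsto_eval_smul_div_pow _ hk w₀).norm.const_mul M) ?_
  filter_upwards [self_mem_nhdsWithin] with s hs
  have hs' : 0 < s := hs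
  rw [eval_translateC, eval_translateC, norm_div, norm_div, ← mul_div_assoc]
  gcongr
  exact h s hs

lemma IsHyperbolicDir.homogeneousComponent_translateC {d m k : ℕ} {A : MvPolynomial (Fin d) ℂ}
    (hA : A.IsHomogeneous m) {u : Fin d → ℝ} (hu : IsHyperbolicDir A u) (x : Fin d → ℝ)
    (hk : ∀ j < k, homogeneousComponent j (translateC A x) = 0)
    (ha0 : homogeneousComponent k (translateC A x) ≠ 0) :
    IsHyperbolicDir (homogeneousComponent k (translateC A x)) u := by
  have hhom := homogeneousComponent_isHomogeneous k (translateC A x)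
  have hne : eval (complexVec u) (homogeneousComponent k (translateC A x)) ≠ 0 := by
    intro h0
    refine ha0 (MvPolynomial.funext_set
      (fun j => Set.range fun r : ℝ => Complex.I * (u j : ℂ) + (r : ℂ)) (fun j => ?_) ?_)
    · exact Set.infinite_range_of_injective fun r r' h => by simpa using h
    intro w hw
    choose y hy using fun j => hw j (Set.mem_univ j)
    obtain rfl : Complex.I • complexVec u + complexVec y = w := by
      ext j; simpa [complexVec] using hy j
    obtain ⟨c, hc, hball⟩ := hu.exists_ball_eval_ne_zero hA y
    have hle := norm_eval_homogeneousComponent_translateC_le hk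
      (w₁ := Complex.I • complexVec u + complexVec y) (w₀ := Complex.I • complexVec u)
      (M := (1 + 1 / c) ^ A.totalDegree) fun s hs => ?_
    · rw [hhom.eval_const_smul, h0, mul_zero, norm_zero, mul_zero] at hle
      simpa using hle
    have hs' : (s : ℂ) ≠ 0 := by exact_mod_cast hs.ne'
    have h := norm_eval_add_smul_le A (complexVec x + (s : ℂ) • Complex.I • complexVec u)
      ((s : ℂ) • complexVec y) hc (fun r hr => ?_) 1
    · simpa [add_assoc] using h
    by_contra! hlt
    refine hball (s⁻¹ • x) r ((Complex.abs_im_le_norm r).trans_lt hlt) ?_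
    have h1 : complexVec x + (s : ℂ) • Complex.I • complexVec u + r • (s : ℂ) • complexVec y =
        (s : ℂ) • (complexVec (s⁻¹ • x) + Complex.I • complexVec u + r • complexVec y) := by
      rw [smul_add, smul_add, complexVec_smul, Complex.ofReal_inv, smul_inv_smul₀ hs',
        smul_comm r]
    rw [h1, hA.eval_const_smul] at hr
    exact (mul_eq_zero.mp hr).resolve_left (pow_ne_zero _ hs')
  refine ⟨hne, fun y t ht => ?_⟩
  change eval (complexVec y + t • complexVec u) _ = 0 at ht
  by_contra him
  have hzero : ∀ q : ℂ, eval (complexVec y + (t + q) • complexVec u)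
      (homogeneousComponent k (translateC A x)) = 0 := by
    intro q
    have hle := norm_eval_homogeneousComponent_translateC_le hk
      (w₁ := complexVec y + (t + q) • complexVec u) (w₀ := complexVec y + t • complexVec u)
      (M := (1 + ‖q‖ / |t.im|) ^ A.totalDegree) fun s hs => ?_
    · rw [ht, norm_zero, mul_zero] at hle
      exact norm_le_zero_iff.mp hle
    have hadd : ∀ r : ℂ, complexVec x + (s : ℂ) • (complexVec y + t • complexVec u) +
        r • (s : ℂ) • complexVec u =
        complexVec (x + s • y) + ((s : ℂ) * (t + r)) • complexVec u := by
      intro r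
      rw [complexVec_add, complexVec_smul]
      module
    have h := norm_eval_add_smul_le A (complexVec x + (s : ℂ) • (complexVec y + t • complexVec u))
      ((s : ℂ) • complexVec u) (abs_pos.mpr him) (fun r hr => ?_) q
    · refine le_trans (le_of_eq ?_) h
      refine congrArg (fun w => ‖eval w A‖) ?_
      module
    rw [hadd] at hr
    have h1 := hu.im_eq_zero _ hr
    rw [Complex.im_ofReal_mul, Complex.add_im] at h1
    have h2 : r.im = -t.im := by
      have := (mul_eq_zero.mp h1).resolve_left hs.ne'
      linarith
    simpa [h2] using Complex.abs_im_le_norm r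
  have hc : Continuous fun r : ℝ => eval (complexVec u + (r : ℂ) • complexVec y)
      (homogeneousComponent k (translateC A x)) :=
    (continuous_eval _).comp (by fun_prop)
  have hlim := (hc.tendsto 0).mono_left (nhdsWithin_le_nhds (s := Set.Ioi 0))
  refine hne ?_
  have h0 : Tendsto (fun r : ℝ => eval (complexVec u + (r : ℂ) • complexVec y)
      (homogeneousComponent k (translateC A x))) (𝓝[>] 0) (𝓝 0) := by
    refine tendsto_const_nhds.congr' ?_
    filter_upwards [self_mem_nhdsWithin] with r hr
    have hr' : (r : ℂ) ≠ 0 := by exact_mod_cast (ne_of_gt hr)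
    have h1 : complexVec u + (r : ℂ) • complexVec y =
        (r : ℂ) • (complexVec y + (t + ((r : ℂ)⁻¹ - t)) • complexVec u) := by
      rw [add_sub_cancel, smul_add, smul_inv_smul₀ hr', add_comm]
    rw [h1, hhom.eval_const_smul, hzero, mul_zero]
  simpa using tendsto_nhds_unique hlim h0

/-- if a homogeneous polynomial `A` is hyperbolic in direction `u` and
`A(x) = 0`, then the leading homogeneous part `a = hom(A, x)` (the homogeneous
component of minimal degree `k` of `w ↦ A(x+w)`) is hyperbolic in direction `u`;
consequently any connected subset of the hyperbolicity directions of `A` lies in a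
single connected component of the hyperbolicity directions of `a`. -/
theorem hom_part_hyperbolic {d m : ℕ} (hm : 1 ≤ m)
    (A : MvPolynomial (Fin d) ℂ) (hA : A.IsHomogeneous m) (hA0 : A ≠ 0)
    (u : Fin d → ℝ) (hu : IsHyperbolicDir A u)
    (x : Fin d → ℝ) (hx : eval (fun j => (x j : ℂ)) A = 0)
    (k : ℕ) (a : MvPolynomial (Fin d) ℂ)
    (hk : ∀ j < k, homogeneousComponent j (translateC A x) = 0)
    (ha : a = homogeneousComponent k (translateC A x)) (ha0 : a ≠ 0) :
    IsHyperbolicDir a u ∧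
    ∀ B : Set (Fin d → ℝ), B ⊆ {w : Fin d → ℝ | IsHyperbolicDir A w} →
      IsConnected B →
        ∃ w₀ : Fin d → ℝ, IsHyperbolicDir a w₀ ∧
          B ⊆ connectedComponentIn {w : Fin d → ℝ | IsHyperbolicDir a w} w₀ := by
  subst ha
  have key : ∀ w, IsHyperbolicDir A w →
      IsHyperbolicDir (homogeneousComponent k (translateC A x)) w :=
    fun w hw => hw.homogeneousComponent_translateC hA x hk ha0
  refine ⟨key u hu, fun B hB hconn => ?_⟩
  obtain ⟨w₀, hw₀⟩ := hconn.nonempty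
  exact ⟨w₀, key w₀ (hB hw₀),
    hconn.isPreconnected.subset_connectedComponentIn hw₀ fun w hw => key w (hB hw)⟩
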